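/- Let M be a positive semidefinite real p×p matrix and let x_i, x_j, x_l ∈ ℝᵖ with v = x_l − x_j. Assume vᵀ M² v ≠ 0 and d²_M(x_i, x_l) > d²_M(x_i, x_j). Then every x ∈ ℝᵖ with d²_M(x, x_l) ≤ d²_M(x, x_j) (i.e. every adversarial example, for which the impostor x_l is at least as close as the target neighbor x_j under the learned metric) satisfies ‖x − x_i‖₂² ≥ (d²_M(x_i, x_l) − d²_M(x_i, x_j))² / (4 · vᵀ M² v). In particular, any perturbation of x_i with Euclidean norm strictly smaller than the adversarial margin cannot change the relative order of the Mahalanobis distances to x_j and x_l. -/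

import Mathlib

open Matrix

/-- A symmetric bilinear form is invariant under swapping its arguments. -/
lemma Matrix.IsSymm.dotProduct_mulVec_comm {n R : Type*} [Fintype n] [CommSemiring R]
    {M : Matrix n n R} (hM : M.IsSymm) (u w : n → R) :
    u ⬝ᵥ (M *ᵥ w) = w ⬝ᵥ (M *ᵥ u) := by
  rw [dotProduct_mulVec, ← mulVec_transpose, hM.eq, dotProduct_comm]

/-- The Cauchy–Schwarz inequality for the dot product. -/
lemma dotProduct_sq_le_dotProduct_mul_dotProduct {n : Type*} [Fintype n] (u w : n → ℝ) :
    (u ⬝ᵥ w) ^ 2 ≤ (u ⬝ᵥ u) * (w ⬝ᵥ w) := by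
  simpa only [dotProduct, sq] using Finset.sum_mul_sq_le_sq_mul_sq Finset.univ u w

/-- Certified robustness: if `d²_M(x_i,x_l) > d²_M(x_i,x_j)`, then every adversarial example
`x` (one with `d²_M(x,x_l) ≤ d²_M(x,x_j)`) satisfies
`‖x − x_i‖₂² ≥ (d²_M(x_i,x_l) − d²_M(x_i,x_j))² / (4 vᵀ M² v)` with `v = x_l − x_j`. -/
theorem adversarial_example_outside_certified_neighborhood {p : ℕ}
    (M : Matrix (Fin p) (Fin p) ℝ) (hM : M.PosSemidef)
    (xi xj xl : Fin p → ℝ)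
    (v : Fin p → ℝ) (hv : v = xl - xj)
    (hc0 : v ⬝ᵥ ((M * M) *ᵥ v) ≠ 0)
    (hgt : (xi - xl) ⬝ᵥ (M *ᵥ (xi - xl)) > (xi - xj) ⬝ᵥ (M *ᵥ (xi - xj))) :
    ∀ x : Fin p → ℝ, (x - xl) ⬝ᵥ (M *ᵥ (x - xl)) ≤ (x - xj) ⬝ᵥ (M *ᵥ (x - xj)) →
      (x - xi) ⬝ᵥ (x - xi) ≥
        ((xi - xl) ⬝ᵥ (M *ᵥ (xi - xl)) - (xi - xj) ⬝ᵥ (M *ᵥ (xi - xj))) ^ 2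
          / (4 * (v ⬝ᵥ ((M * M) *ᵥ v))) := by
  intro x hx
  have hS : M.IsSymm := by simpa [IsHermitian, IsSymm] using hM.isHermitian
  have hMM : v ⬝ᵥ ((M * M) *ᵥ v) = (M *ᵥ v) ⬝ᵥ (M *ᵥ v) := by
    rw [← mulVec_mulVec, hS.dotProduct_mulVec_comm]
  have hpos : 0 < v ⬝ᵥ ((M * M) *ᵥ v) := by
    refine lt_of_le_of_ne ?_ hc0.symm
    rw [hMM]
    exact Finset.sum_nonneg fun i _ => mul_self_nonneg _
  have expand (w a : Fin p → ℝ) : (w + a) ⬝ᵥ (M *ᵥ (w + a)) =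
      w ⬝ᵥ (M *ᵥ w) + 2 * (w ⬝ᵥ (M *ᵥ a)) + a ⬝ᵥ (M *ᵥ a) := by
    simp only [mulVec_add, add_dotProduct, dotProduct_add, hS.dotProduct_mulVec_comm a w]
    ring
  have hv' : v = (xi - xj) - (xi - xl) := by rw [hv]; abel
  have hwv : (x - xi) ⬝ᵥ (M *ᵥ v) =
      (x - xi) ⬝ᵥ (M *ᵥ (xi - xj)) - (x - xi) ⬝ᵥ (M *ᵥ (xi - xl)) := by
    rw [hv', mulVec_sub, dotProduct_sub]
  rw [← sub_add_sub_cancel x xi xl, ← sub_add_sub_cancel x xi xj, expand, expand] at hx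
  have hcs := dotProduct_sq_le_dotProduct_mul_dotProduct (x - xi) (M *ᵥ v)
  rw [← hMM] at hcs
  rw [ge_iff_le, div_le_iff₀ (by positivity)]
  have hsq := pow_le_pow_left₀ (sub_pos.mpr hgt).le
    (show _ ≤ 2 * ((x - xi) ⬝ᵥ (M *ᵥ v)) by linarith) 2
  linarith
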